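/- Let A be a complex unital Banach algebra, let m ≥ 1, let a_1, …, a_m ∈ A, and set U = exp(a_m) · exp(a_{m-1}) ⋯ exp(a_1) (largest index leftmost); U is invertible with inverse exp(-a_1) ⋯ exp(-a_m). Then for every b ∈ A: U⁻¹ b U = ∑_{n=0}^∞ ∑_{z ∈ {1,…,m}^n} Υ(z) · [[⋯[[b, a_{z_1}], a_{z_2}] ⋯], a_{z_n}], where the term n = 0 is b, each inner sum is finite, and the outer series over n converges absolutely in A. -/

import Mathlib

open scoped BigOperators

/-- The `Υ` function on a finite sequence of naturals: `0` unless the sequence is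
nonincreasing, and `1 / ∏_v m_v!` otherwise, where `m_v` is the number of entries
equal to `v`. -/
noncomputable def Upsilon {n : ℕ} (z : Fin n → ℕ) : ℚ :=
  if ∀ i j : Fin n, i ≤ j → z j ≤ z i then
    ((∏ v ∈ Finset.univ.image z,
        (Finset.univ.filter fun i => z i = v).card.factorial : ℕ) : ℚ)⁻¹
  else 0

/-- The iterated (nested) commutator of `a` with the entries of the list `l`,
formed by commuting first with the head of `l`. -/
def nestComm {R : Type*} [Ring R] (a : R) (l : List R) : R :=
  l.foldl (fun x h => x * h - h * x) a

/-- The weight `Υ` of a list of natural numbers. -/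
noncomputable def listUpsilon (l : List ℕ) : ℚ :=
  if l.Pairwise (· ≥ ·) then ((∏ v ∈ l.toFinset, (l.count v).factorial : ℕ) : ℚ)⁻¹ else 0

theorem count_ofFn_eq_card_filter {n : ℕ} (z : Fin n → ℕ) (v : ℕ) :
    (List.ofFn z).count v = (Finset.univ.filter fun i => z i = v).card := by
  induction n with
  | zero => simp
  | succ n ih =>
    rw [List.ofFn_succ, List.count_cons, ih, Fin.card_filter_univ_succ]
    by_cases h : z 0 = v <;> simp [h]

theorem Upsilon_eq_listUpsilon {n : ℕ} (z : Fin n → ℕ) :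
    Upsilon z = listUpsilon (List.ofFn z) := by
  have hmono : (∀ i j : Fin n, i ≤ j → z j ≤ z i) ↔ (List.ofFn z).Pairwise (· ≥ ·) := by
    rw [List.pairwise_ofFn]
    refine ⟨fun h i j hij => h i j hij.le, fun h i j hij => ?_⟩
    rcases hij.eq_or_lt with rfl | hlt
    · exact le_rfl
    · exact h hlt
  have himage : (List.ofFn z).toFinset = Finset.univ.image z := by
    ext v
    simp [List.mem_ofFn]
  simp only [Upsilon, listUpsilon, hmono, himage, count_ofFn_eq_card_filter]

theorem listUpsilon_replicate_append (m k : ℕ) (l : List ℕ) (hl : ∀ x ∈ l, x ≤ m) :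
    listUpsilon (List.replicate k (m + 1) ++ l) =
      ((k.factorial : ℕ) : ℚ)⁻¹ * listUpsilon l := by
  have hpair : (List.replicate k (m + 1) ++ l).Pairwise (· ≥ ·) ↔ l.Pairwise (· ≥ ·) := by
    rw [List.pairwise_append]
    refine ⟨fun h => h.2.1, fun h => ⟨?_, h, ?_⟩⟩
    · exact List.pairwise_replicate.2 (Or.inr le_rfl)
    · intro x hx y hy
      have := hl y hy
      rw [List.eq_of_mem_replicate hx]
      omega
  have hnot : m + 1 ∉ l := fun h => by
    have := hl _ h
    omega
  have hcount : l.count (m + 1) = 0 := List.count_eq_zero_of_not_mem hnot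
  have hprod : ∏ v ∈ (List.replicate k (m + 1) ++ l).toFinset,
      ((List.replicate k (m + 1) ++ l).count v).factorial =
        k.factorial * ∏ v ∈ l.toFinset, (l.count v).factorial := by
    have hsub : (List.replicate k (m + 1) ++ l).toFinset ⊆ insert (m + 1) l.toFinset := by
      intro v hv
      simp only [List.mem_toFinset, List.mem_append, Finset.mem_insert] at hv ⊢
      exact hv.imp List.eq_of_mem_replicate id
    rw [Finset.prod_subset hsub, Finset.prod_insert (by simpa using hnot)]
    · congr 1
      · simp [List.count_append, hcount]
      · refine Finset.prod_congr rfl fun v hv => ?_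
        have hne : m + 1 ≠ v := fun h => hnot (h ▸ List.mem_toFinset.1 hv)
        simp [List.count_append, List.count_replicate, hne]
    · intro v _ hv
      rw [List.mem_toFinset] at hv
      simp [List.count_eq_zero_of_not_mem hv]
  unfold listUpsilon
  by_cases h : l.Pairwise (· ≥ ·)
  · rw [if_pos (hpair.2 h), if_pos h, hprod, Nat.cast_mul, mul_inv]
  · rw [if_neg (hpair.not.2 h), if_neg h, mul_zero]

theorem listUpsilon_eq_zero {l : List ℕ} (h : ¬ l.Pairwise (· ≥ ·)) : listUpsilon l = 0 :=
  if_neg h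

/-- The sum of `f` over all lists of length `n` with entries in `{1, …, m}`. -/
def tupleSum {M : Type*} [AddCommMonoid M] (m n : ℕ) (f : List ℕ → M) : M :=
  ∑ z ∈ Fintype.piFinset fun _ : Fin n => Finset.Icc 1 m, f (List.ofFn z)

section TupleSum

variable {M : Type*} [AddCommMonoid M]

theorem tupleSum_congr {m n : ℕ} {f g : List ℕ → M}
    (h : ∀ l : List ℕ, (∀ x ∈ l, x ≤ m) → f l = g l) : tupleSum m n f = tupleSum m n g := by
  refine Finset.sum_congr rfl fun z hz => h _ fun x hx => ?_
  obtain ⟨i, rfl⟩ := List.mem_ofFn.1 hx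
  exact (Finset.mem_Icc.1 (Fintype.mem_piFinset.1 hz i)).2

@[simp]
theorem tupleSum_zero_right (m : ℕ) (f : List ℕ → M) : tupleSum m 0 f = f [] := by
  simp [tupleSum]

theorem tupleSum_succ_right (m n : ℕ) (f : List ℕ → M) :
    tupleSum m (n + 1) f = ∑ v ∈ Finset.Icc 1 m, tupleSum m n fun l => f (v :: l) := by
  unfold tupleSum
  rw [← Finset.sum_product']
  symm
  refine Finset.sum_bij' (fun p _ => Fin.cons p.1 p.2) (fun z _ => (z 0, Fin.tail z))
    ?_ ?_ ?_ ?_ ?_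
  · rintro ⟨v, z⟩ h
    rw [Finset.mem_product] at h
    rw [Fintype.mem_piFinset]
    refine Fin.cases ?_ fun i => ?_
    · simpa using h.1
    · simpa using Fintype.mem_piFinset.1 h.2 i
  · intro z h
    rw [Fintype.mem_piFinset] at h
    exact Finset.mem_product.2 ⟨h 0, Fintype.mem_piFinset.2 fun i => h i.succ⟩
  · rintro ⟨v, z⟩ _
    simp
  · intro z _
    simp
  · rintro ⟨v, z⟩ _
    simp [List.ofFn_succ]

theorem tupleSum_eq_zero {m n : ℕ} {f : List ℕ → M} (h : ∀ l : List ℕ, f l = 0) :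
    tupleSum m n f = 0 :=
  Finset.sum_eq_zero fun _ _ => h _

theorem tupleSum_succ_left_cons {m v : ℕ} (hv : v ≤ m) (n : ℕ) :
    ∀ (p : List ℕ) (f : List ℕ → M), (∀ l : List ℕ, ¬ l.Pairwise (· ≥ ·) → f l = 0) →
      v ∈ p → (tupleSum (m + 1) n fun l => f (p ++ l)) = tupleSum m n fun l => f (p ++ l) := by
  induction n with
  | zero => simp
  | succ n ih =>
    intro p f hf hp
    rw [tupleSum_succ_right, tupleSum_succ_right,
      Finset.sum_Icc_succ_top (by omega : 1 ≤ m + 1)]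
    rw [tupleSum_eq_zero (m := m + 1) (n := n) (f := fun l => f (p ++ (m + 1) :: l)), add_zero]
    · refine Finset.sum_congr rfl fun w _ => ?_
      have := ih (p ++ [w]) f hf (by simp [hp])
      simpa using this
    · intro l
      refine hf _ fun hl => ?_
      have := (List.pairwise_append.1 hl).2.2 v hp (m + 1) (by simp)
      omega

theorem tupleSum_succ_left (m n : ℕ) (f : List ℕ → M)
    (hf : ∀ l : List ℕ, ¬ l.Pairwise (· ≥ ·) → f l = 0) :
    tupleSum (m + 1) n f = ∑ kl ∈ Finset.HasAntidiagonal.antidiagonal n,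
      tupleSum m kl.2 fun l => f (List.replicate kl.1 (m + 1) ++ l) := by
  induction n generalizing f with
  | zero => simp
  | succ n ih =>
    rw [Finset.Nat.sum_antidiagonal_succ, tupleSum_succ_right,
      Finset.sum_Icc_succ_top (by omega : 1 ≤ m + 1),
      ih (fun l => f ((m + 1) :: l)) fun l hl => hf _ fun h => hl (List.pairwise_cons.1 h).2]
    congr 1
    simp only [List.replicate_zero, List.nil_append]
    rw [tupleSum_succ_right]
    refine Finset.sum_congr rfl fun v hv => ?_
    exact tupleSum_succ_left_cons (Finset.mem_Icc.1 hv).2 n [v] f hf (by simp)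

theorem smul_tupleSum {R : Type*} [DistribSMul R M] (c : R) (m n : ℕ) (f : List ℕ → M) :
    c • tupleSum m n f = tupleSum m n fun l => c • f l :=
  Finset.smul_sum

end TupleSum

section Conjugation

open NormedSpace

variable {A : Type*} [NormedRing A]

/-- The product `exp (a m) ⋯ exp (a 1)`. -/
noncomputable def expProd (a : ℕ → A) (m : ℕ) : A :=
  (List.ofFn fun i : Fin m => exp (a (m - (i : ℕ)))).prod

/-- The product `exp (-a 1) ⋯ exp (-a m)`. -/
noncomputable def expNegProd (a : ℕ → A) (m : ℕ) : A :=
  (List.ofFn fun i : Fin m => exp (-a ((i : ℕ) + 1))).prod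

theorem expProd_succ (a : ℕ → A) (m : ℕ) :
    expProd a (m + 1) = exp (a (m + 1)) * expProd a m := by
  simp [expProd, List.ofFn_succ]

theorem expNegProd_succ (a : ℕ → A) (m : ℕ) :
    expNegProd a (m + 1) = expNegProd a m * exp (-a (m + 1)) := by
  simp [expNegProd, List.ofFn_succ', -List.ofFn_succ]

variable [NormedAlgebra ℂ A]

/-- The bounded operator `x ↦ x a - a x`. -/
noncomputable def commutatorCLM (a : A) : A →L[ℂ] A :=
  (ContinuousLinearMap.mul ℂ A).flip a - ContinuousLinearMap.mul ℂ A a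

@[simp]
theorem commutatorCLM_apply (a x : A) : commutatorCLM a x = x * a - a * x := rfl

theorem nestComm_replicate_append (b a : A) (k : ℕ) (l : List A) :
    nestComm b (List.replicate k a ++ l) = nestComm ((commutatorCLM a ^ k) b) l := by
  induction k generalizing b with
  | zero => simp
  | succ k ih =>
    rw [pow_succ, mul_apply_eq_comp, ← ih]
    rfl

/-- The degree `n` part of the composition of the exponential series of the operators
`commutatorCLM (a 1), …, commutatorCLM (a m)`. -/
noncomputable def commutatorTerm (a : ℕ → A) : ℕ → ℕ → A →L[ℂ] A
  | 0, n => if n = 0 then 1 else 0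
  | m + 1, n => ∑ kl ∈ Finset.HasAntidiagonal.antidiagonal n, commutatorTerm a m kl.2 *
      ((kl.1.factorial : ℂ)⁻¹ • commutatorCLM (a (m + 1)) ^ kl.1)

theorem tupleSum_listUpsilon_smul_nestComm (a : ℕ → A) (m n : ℕ) (b : A) :
    (tupleSum m n fun l => ((listUpsilon l : ℚ) : ℂ) • nestComm b (l.map a)) =
      commutatorTerm a m n b := by
  induction m generalizing n b with
  | zero =>
    cases n with
    | zero => simp [commutatorTerm, listUpsilon, nestComm]
    | succ n => simp [tupleSum_succ_right, commutatorTerm]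
  | succ m ih =>
    rw [tupleSum_succ_left _ _ _ fun l hl => by simp [listUpsilon_eq_zero hl], commutatorTerm,
      sum_apply]
    refine Finset.sum_congr rfl fun kl _ => ?_
    rw [mul_apply_eq_comp, smul_apply, map_smul, ← ih, smul_tupleSum]
    refine tupleSum_congr fun l hl => ?_
    rw [listUpsilon_replicate_append m kl.1 l hl, List.map_append, List.map_replicate,
      nestComm_replicate_append, smul_smul]
    push_cast
    rfl

theorem summable_norm_commutatorTerm (a : ℕ → A) (m : ℕ) :
    Summable fun n => ‖commutatorTerm a m n‖ := by
  induction m with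
  | zero =>
    refine summable_of_ne_finset_zero (s := {0}) fun n hn => ?_
    simp [commutatorTerm, Finset.mem_singleton.not.1 hn]
  | succ m ih =>
    have h := summable_norm_sum_mul_antidiagonal_of_summable_norm ih
      (norm_expSeries_summable' (𝕂 := ℂ) (commutatorCLM (a (m + 1))))
    refine h.congr fun n => ?_
    rw [commutatorTerm, ← Finset.Nat.sum_antidiagonal_swap]
    rfl

variable [CompleteSpace A]

theorem exp_neg_mul_exp (a : A) : exp (-a) * exp a = 1 := by
  let _ : NormedAlgebra ℚ A := NormedAlgebra.restrictScalars ℚ ℂ A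
  rw [← exp_add_of_commute (Commute.refl a).neg_left, neg_add_cancel, exp_zero]

theorem exp_mul_exp_neg (a : A) : exp a * exp (-a) = 1 := by
  simpa using exp_neg_mul_exp (-a)

theorem exp_mul_left_apply (a x : A) : exp (ContinuousLinearMap.mul ℂ A a) x = exp a * x := by
  have hpow (n : ℕ) : (ContinuousLinearMap.mul ℂ A a ^ n) x = a ^ n * x := by
    induction n with
    | zero => simp
    | succ n ih => rw [pow_succ', mul_apply_eq_comp, ih, pow_succ', mul_assoc]; rfl
  have h := (exp_series_hasSum_exp' (𝕂 := ℂ) (ContinuousLinearMap.mul ℂ A a)).mapL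
    (ContinuousLinearMap.apply ℂ A x)
  have h' := (exp_series_hasSum_exp' (𝕂 := ℂ) a).mul_right x
  refine h.unique (h'.congr_fun fun n => ?_)
  simp [hpow]

theorem exp_mul_right_apply (a x : A) :
    exp ((ContinuousLinearMap.mul ℂ A).flip a) x = x * exp a := by
  have hpow (n : ℕ) : ((ContinuousLinearMap.mul ℂ A).flip a ^ n) x = x * a ^ n := by
    induction n with
    | zero => simp
    | succ n ih => rw [pow_succ', mul_apply_eq_comp, ih, pow_succ, ← mul_assoc]; rfl
  have h := (exp_series_hasSum_exp' (𝕂 := ℂ) ((ContinuousLinearMap.mul ℂ A).flip a)).mapL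
    (ContinuousLinearMap.apply ℂ A x)
  have h' := (exp_series_hasSum_exp' (𝕂 := ℂ) a).mul_left x
  refine h.unique (h'.congr_fun fun n => ?_)
  simp [hpow]

theorem exp_commutatorCLM_apply (a x : A) :
    exp (commutatorCLM a) x = exp (-a) * x * exp a := by
  let _ : NormedAlgebra ℚ (A →L[ℂ] A) := NormedAlgebra.restrictScalars ℚ ℂ (A →L[ℂ] A)
  have hcomm : Commute (ContinuousLinearMap.mul ℂ A (-a))
      ((ContinuousLinearMap.mul ℂ A).flip a) := by
    ext x
    simp [mul_assoc]
  have hsum : commutatorCLM a =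
      ContinuousLinearMap.mul ℂ A (-a) + (ContinuousLinearMap.mul ℂ A).flip a := by
    ext x
    simp [sub_eq_neg_add]
  rw [hsum, exp_add_of_commute hcomm, mul_apply_eq_comp, exp_mul_right_apply,
    exp_mul_left_apply, mul_assoc]

theorem tsum_commutatorTerm_succ (a : ℕ → A) (m : ℕ) :
    ∑' n, commutatorTerm a (m + 1) n =
      (∑' n, commutatorTerm a m n) * exp (commutatorCLM (a (m + 1))) := by
  rw [exp_eq_tsum ℂ, tsum_mul_tsum_eq_tsum_sum_antidiagonal_of_summable_norm
    (summable_norm_commutatorTerm a m) (norm_expSeries_summable' (𝕂 := ℂ) _)]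
  refine tsum_congr fun n => ?_
  rw [commutatorTerm, ← Finset.Nat.sum_antidiagonal_swap]
  rfl

theorem expNegProd_mul_expProd (a : ℕ → A) (m : ℕ) : expNegProd a m * expProd a m = 1 := by
  induction m with
  | zero => simp [expProd, expNegProd]
  | succ m ih =>
    rw [expProd_succ, expNegProd_succ, mul_assoc, ← mul_assoc (exp (-a (m + 1))),
      exp_neg_mul_exp, one_mul, ih]

theorem expProd_mul_expNegProd (a : ℕ → A) (m : ℕ) : expProd a m * expNegProd a m = 1 := by
  induction m with
  | zero => simp [expProd, expNegProd]
  | succ m ih =>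
    rw [expProd_succ, expNegProd_succ, mul_assoc, ← mul_assoc (expProd a m), ih, one_mul,
      exp_mul_exp_neg]

theorem tsum_commutatorTerm_apply (a : ℕ → A) (m : ℕ) (b : A) :
    (∑' n, commutatorTerm a m n) b = expNegProd a m * b * expProd a m := by
  induction m generalizing b with
  | zero => simp [commutatorTerm, expProd, expNegProd]
  | succ m ih =>
    rw [tsum_commutatorTerm_succ, mul_apply_eq_comp, exp_commutatorCLM_apply, ih,
      expProd_succ, expNegProd_succ]
    simp only [mul_assoc]

end Conjugation

/-- With `U = exp(a_m) ⋯ exp(a_1)` (invertible, with inverse `exp(-a_1) ⋯ exp(-a_m)`),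
for every `b` the conjugation `U⁻¹ b U` equals the absolutely convergent series
`∑ₙ ∑_{z ∈ {1,…,m}ⁿ} Υ(z) • [[⋯[[b, a_{z₁}], a_{z₂}] ⋯], a_{z_n}]`. -/
theorem conjugation_by_exp_prod_eq_upsilon_commutator_series {A : Type*}
    [NormedRing A] [NormedAlgebra ℂ A] [CompleteSpace A] (m : ℕ) (hm : 1 ≤ m)
    (a : ℕ → A) (U Uinv : A)
    (hU : U = (List.ofFn fun i : Fin m => NormedSpace.exp (a (m - (i : ℕ)))).prod)
    (hUinv : Uinv =
      (List.ofFn fun i : Fin m => NormedSpace.exp (-a ((i : ℕ) + 1))).prod) :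
    Uinv * U = 1 ∧ U * Uinv = 1 ∧
      ∀ b : A,
        Summable (fun n : ℕ =>
          ‖∑ z ∈ Fintype.piFinset fun _ : Fin n => Finset.Icc 1 m,
            ((Upsilon z : ℚ) : ℂ) •
              nestComm b (List.ofFn fun i : Fin n => a (z i))‖) ∧
        HasSum (fun n : ℕ =>
          ∑ z ∈ Fintype.piFinset fun _ : Fin n => Finset.Icc 1 m,
            ((Upsilon z : ℚ) : ℂ) •
              nestComm b (List.ofFn fun i : Fin n => a (z i)))
          (Uinv * b * U) := by
  change U = expProd a m at hU
  change Uinv = expNegProd a m at hUinv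
  subst hU hUinv
  refine ⟨expNegProd_mul_expProd a m, expProd_mul_expNegProd a m, fun b => ?_⟩
  have hterm (n : ℕ) : (∑ z ∈ Fintype.piFinset fun _ : Fin n => Finset.Icc 1 m,
      ((Upsilon z : ℚ) : ℂ) • nestComm b (List.ofFn fun i : Fin n => a (z i))) =
        commutatorTerm a m n b := by
    rw [← tupleSum_listUpsilon_smul_nestComm]
    refine Finset.sum_congr rfl fun z _ => ?_
    simp only [Upsilon_eq_listUpsilon, List.map_ofFn, Function.comp_def]
  simp only [hterm]
  have hsum := summable_norm_commutatorTerm a m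
  constructor
  · exact Summable.of_nonneg_of_le (fun _ => norm_nonneg _)
      (fun n => (commutatorTerm a m n).le_opNorm b) (hsum.mul_right ‖b‖)
  · rw [← tsum_commutatorTerm_apply]
    exact hsum.of_norm.hasSum.mapL (ContinuousLinearMap.apply ℂ A b)
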